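/- (Case 2: single transition.) Write λ₂⁽¹⁾ = λ₂(L₁) and λ₂⁽²⁾ = λ₂(L₂), and assume n > m and m·λ₂⁽¹⁾ < n·λ₂⁽²⁾ (i.e. λ₂⁽¹⁾/n < λ₂⁽²⁾/m). Set c* = m·λ₂⁽¹⁾. Then for uniform all-pairs weights: λ₂(L(W_c)) = (1/n + 1/m)·c for 0 ≤ c ≤ c*, and λ₂(L(W_c)) = λ₂⁽¹⁾ + c/n for c ≥ c*. -/

import Mathlib

open Matrix

noncomputable def supraLap {n m : ℕ} (L₁ : Matrix (Fin n) (Fin n) ℝ)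
    (L₂ : Matrix (Fin m) (Fin m) ℝ) (W : Matrix (Fin n) (Fin m) ℝ) :
    Matrix (Fin n ⊕ Fin m) (Fin n ⊕ Fin m) ℝ :=
  Matrix.fromBlocks (L₁ + Matrix.diagonal (W *ᵥ fun _ => 1)) (-W)
    (-Wᵀ) (L₂ + Matrix.diagonal (Wᵀ *ᵥ fun _ => 1))

noncomputable def lam2 {K : Type*} [Fintype K] (M : Matrix K K ℝ) : ℝ :=
  sInf {r : ℝ | ∃ v : K → ℝ, v ≠ 0 ∧ (∑ i, v i) = 0 ∧
    r = (v ⬝ᵥ (M *ᵥ v)) / (∑ i, (v i) ^ 2)}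

lemma lam2_bdd {K : Type*} [Fintype K] (M : Matrix K K ℝ)
    (h : ∀ v : K → ℝ, 0 ≤ v ⬝ᵥ (M *ᵥ v)) :
    BddBelow {r : ℝ | ∃ v : K → ℝ, v ≠ 0 ∧ (∑ i, v i) = 0 ∧
      r = (v ⬝ᵥ (M *ᵥ v)) / (∑ i, (v i) ^ 2)} := by
  refine ⟨0, ?_⟩
  rintro r ⟨v, -, -, rfl⟩
  exact div_nonneg (h v) (Finset.sum_nonneg fun i _ => sq_nonneg _)

lemma sumsq_pos {K : Type*} [Fintype K] (v : K → ℝ) (hv : v ≠ 0) : 0 < ∑ i, (v i) ^ 2 := by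
  obtain ⟨i, hi⟩ := Function.ne_iff.mp hv
  exact Finset.sum_pos' (fun i _ => sq_nonneg _) ⟨i, Finset.mem_univ _, by
    have : v i ≠ 0 := hi
    positivity⟩

lemma lam2_mul_le {K : Type*} [Fintype K] (M : Matrix K K ℝ)
    (h : ∀ v : K → ℝ, 0 ≤ v ⬝ᵥ (M *ᵥ v)) (v : K → ℝ) (hs : ∑ i, v i = 0) :
    lam2 M * ∑ i, (v i) ^ 2 ≤ v ⬝ᵥ (M *ᵥ v) := by
  by_cases hv : v = 0
  · subst hv; simp
  · have h1 : lam2 M ≤ (v ⬝ᵥ (M *ᵥ v)) / (∑ i, (v i) ^ 2) :=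
      csInf_le (lam2_bdd M h) ⟨v, hv, hs, rfl⟩
    rwa [le_div_iff₀ (sumsq_pos v hv)] at h1

lemma le_lam2 {K : Type*} [Fintype K] (M : Matrix K K ℝ) (μ : ℝ)
    (hne : ∃ v : K → ℝ, v ≠ 0 ∧ ∑ i, v i = 0)
    (h : ∀ v : K → ℝ, v ≠ 0 → ∑ i, v i = 0 → μ * ∑ i, (v i) ^ 2 ≤ v ⬝ᵥ (M *ᵥ v)) :
    μ ≤ lam2 M := by
  obtain ⟨v, hv, hs⟩ := hne
  refine le_csInf ⟨_, v, hv, hs, rfl⟩ ?_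
  rintro r ⟨v, hv, hs, rfl⟩
  rw [le_div_iff₀ (sumsq_pos v hv)]
  exact h v hv hs

lemma psd_form {K : Type*} [Fintype K] (M : Matrix K K ℝ) (h : M.PosSemidef) (v : K → ℝ) :
    0 ≤ v ⬝ᵥ (M *ᵥ v) := by
  simpa using h.dotProduct_mulVec_nonneg v

lemma shift_bound {n : ℕ} (hn : 2 ≤ n) (L : Matrix (Fin n) (Fin n) ℝ) (h : L.PosSemidef)
    (h1 : L *ᵥ (fun _ => 1) = 0) (x : Fin n → ℝ) :
    lam2 L * (∑ i, (x i) ^ 2 - (∑ i, x i) ^ 2 / n) ≤ x ⬝ᵥ (L *ᵥ x) := by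
  have hn0 : (n : ℝ) ≠ 0 := by
    have : n ≠ 0 := by omega
    exact_mod_cast this
  set a : ℝ := (∑ i, x i) / n with ha
  have key := lam2_mul_le L (psd_form L h) (x - a • fun _ => 1) (by
    simp [Finset.sum_sub_distrib, ha]; field_simp; ring)
  have e1 : ∑ i, ((x - a • fun _ => (1:ℝ) : Fin n → ℝ) i) ^ 2 = ∑ i, (x i) ^ 2 - (∑ i, x i) ^ 2 / n := by
    simp only [Pi.sub_apply, Pi.smul_apply, smul_eq_mul, mul_one, sub_sq,
      Finset.sum_add_distrib, Finset.sum_sub_distrib, ← Finset.sum_mul, ← Finset.mul_sum]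
    simp [ha]; field_simp; ring
  have hT : Lᵀ = L := by simpa [Matrix.IsHermitian] using h.isHermitian
  have e3 : (fun _ => (1:ℝ)) ⬝ᵥ (L *ᵥ x) = 0 := by
    rw [Matrix.dotProduct_mulVec, ← Matrix.mulVec_transpose, hT, h1]; simp
  have e2 : (x - a • fun _ => (1:ℝ)) ⬝ᵥ (L *ᵥ (x - a • fun _ => (1:ℝ))) = x ⬝ᵥ (L *ᵥ x) := by
    rw [Matrix.mulVec_sub, Matrix.mulVec_smul, h1, smul_zero, sub_zero, sub_dotProduct,
      smul_dotProduct, e3]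
    simp
  rwa [e1, e2] at key

lemma supra_form {n m : ℕ} (L₁ : Matrix (Fin n) (Fin n) ℝ) (L₂ : Matrix (Fin m) (Fin m) ℝ)
    (w : ℝ) (v : Fin n ⊕ Fin m → ℝ) :
    v ⬝ᵥ (supraLap L₁ L₂ (Matrix.of fun _ _ => w) *ᵥ v) =
      (v ∘ Sum.inl) ⬝ᵥ (L₁ *ᵥ (v ∘ Sum.inl)) + (v ∘ Sum.inr) ⬝ᵥ (L₂ *ᵥ (v ∘ Sum.inr))
      + m * w * ∑ i, (v (Sum.inl i)) ^ 2 + n * w * ∑ i, (v (Sum.inr i)) ^ 2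
      - 2 * w * (∑ i, v (Sum.inl i)) * (∑ i, v (Sum.inr i)) := by
  have e1 : (Matrix.of fun _ _ => w : Matrix (Fin n) (Fin m) ℝ) *ᵥ (v ∘ Sum.inr)
      = fun _ => w * ∑ i, v (Sum.inr i) := by
    ext i; simp [Matrix.mulVec, dotProduct, Finset.mul_sum]
  have e2 : (Matrix.of fun _ _ => w : Matrix (Fin n) (Fin m) ℝ)ᵀ *ᵥ (v ∘ Sum.inl)
      = fun _ => w * ∑ i, v (Sum.inl i) := by
    ext i; simp [Matrix.mulVec, dotProduct, Finset.mul_sum]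
  have d1 : (Matrix.of fun _ _ => w : Matrix (Fin n) (Fin m) ℝ) *ᵥ (fun _ => 1)
      = fun _ => m * w := by
    ext i; simp [Matrix.mulVec, dotProduct]
  have d2 : (Matrix.of fun _ _ => w : Matrix (Fin n) (Fin m) ℝ)ᵀ *ᵥ (fun _ => 1)
      = fun _ => n * w := by
    ext i; simp [Matrix.mulVec, dotProduct]
  have f1 : (v ∘ Sum.inl) ⬝ᵥ (Matrix.diagonal (fun _ : Fin n => m * w) *ᵥ (v ∘ Sum.inl))
      = m * w * ∑ i, (v (Sum.inl i)) ^ 2 := by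
    simp only [dotProduct, Matrix.mulVec_diagonal, Finset.mul_sum, Function.comp]
    exact Finset.sum_congr rfl fun i _ => by ring
  have f2 : (v ∘ Sum.inr) ⬝ᵥ (Matrix.diagonal (fun _ : Fin m => n * w) *ᵥ (v ∘ Sum.inr))
      = n * w * ∑ i, (v (Sum.inr i)) ^ 2 := by
    simp only [dotProduct, Matrix.mulVec_diagonal, Finset.mul_sum, Function.comp]
    exact Finset.sum_congr rfl fun i _ => by ring
  have g1 : ∀ t : ℝ, (v ∘ Sum.inl) ⬝ᵥ (fun _ => t) = (∑ i, v (Sum.inl i)) * t := by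
    intro t; simp [dotProduct, Finset.sum_mul]
  have g2 : ∀ t : ℝ, (v ∘ Sum.inr) ⬝ᵥ (fun _ => t) = (∑ i, v (Sum.inr i)) * t := by
    intro t; simp [dotProduct, Finset.sum_mul]
  have hv : v = Sum.elim (v ∘ Sum.inl) (v ∘ Sum.inr) := by simp
  have hd : ∀ (p : Fin n → ℝ) (q : Fin m → ℝ), v ⬝ᵥ Sum.elim p q =
      (v ∘ Sum.inl) ⬝ᵥ p + (v ∘ Sum.inr) ⬝ᵥ q := by
    intro p q; simp [dotProduct]
  rw [supraLap, Matrix.fromBlocks_mulVec, hd]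
  simp only [Matrix.add_mulVec, Matrix.neg_mulVec, dotProduct_add, dotProduct_neg, e1, e2, d1, d2,
    f1, f2, g1, g2]
  ring

lemma supra_lower {n m : ℕ} (hn : 2 ≤ n) (hm : 2 ≤ m)
    (L₁ : Matrix (Fin n) (Fin n) ℝ) (L₂ : Matrix (Fin m) (Fin m) ℝ)
    (hL₁ : L₁.PosSemidef) (hL₂ : L₂.PosSemidef)
    (hL₁1 : L₁ *ᵥ (fun _ => 1) = 0) (hL₂1 : L₂ *ᵥ (fun _ => 1) = 0) (c μ : ℝ)
    (h1 : μ ≤ lam2 L₁ + c / n) (h2 : μ ≤ lam2 L₂ + c / m)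
    (h3 : μ ≤ (1 / (n : ℝ) + 1 / (m : ℝ)) * c) (v : Fin n ⊕ Fin m → ℝ) (hs : ∑ i, v i = 0) :
    μ * ∑ i, (v i) ^ 2 ≤
      v ⬝ᵥ (supraLap L₁ L₂ (Matrix.of fun _ _ => c / ((n : ℝ) * m)) *ᵥ v) := by
  have hn0 : (0:ℝ) < n := by exact_mod_cast (by omega : 0 < n)
  have hm0 : (0:ℝ) < m := by exact_mod_cast (by omega : 0 < m)
  rw [supra_form]
  have b1 := shift_bound hn L₁ hL₁ hL₁1 (v ∘ Sum.inl)
  have b2 := shift_bound hm L₂ hL₂ hL₂1 (v ∘ Sum.inr)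
  have c1 : (∑ i, (v ∘ Sum.inl) i) ^ 2 ≤ n * ∑ i, ((v ∘ Sum.inl) i) ^ 2 := by
    simpa using sq_sum_le_card_mul_sum_sq (s := Finset.univ) (f := v ∘ Sum.inl)
  have c2 : (∑ i, (v ∘ Sum.inr) i) ^ 2 ≤ m * ∑ i, ((v ∘ Sum.inr) i) ^ 2 := by
    simpa using sq_sum_le_card_mul_sum_sq (s := Finset.univ) (f := v ∘ Sum.inr)
  rw [Fintype.sum_sum_type] at hs ⊢
  simp only [Function.comp_apply] at b1 b2 c1 c2
  have hy : ∑ i, v (Sum.inr i) = - ∑ i, v (Sum.inl i) := by linarith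
  rw [hy] at b2 c2 ⊢
  generalize (v ∘ Sum.inl) ⬝ᵥ (L₁ *ᵥ (v ∘ Sum.inl)) = Q1 at *
  generalize (v ∘ Sum.inr) ⬝ᵥ (L₂ *ᵥ (v ∘ Sum.inr)) = Q2 at *
  generalize ∑ i, v (Sum.inl i) = s at *
  generalize ∑ i, (v (Sum.inl i)) ^ 2 = X at *
  generalize ∑ i, (v (Sum.inr i)) ^ 2 = Y at *
  have c1' : 0 ≤ X - s ^ 2 / n := by
    rw [sub_nonneg, div_le_iff₀ hn0]; linarith
  have c2' : 0 ≤ Y - (-s) ^ 2 / m := by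
    rw [sub_nonneg, div_le_iff₀ hm0]; linarith
  have c3 : 0 ≤ s ^ 2 / n + s ^ 2 / m := by positivity
  have k1 := mul_le_mul_of_nonneg_right h1 c1'
  have k2 := mul_le_mul_of_nonneg_right h2 c2'
  have k3 := mul_le_mul_of_nonneg_right h3 c3
  have e : m * (c / (n * m)) * X + n * (c / (n * m)) * Y - 2 * (c / (n * m)) * s * -s
      = c / n * (X - s ^ 2 / n) + c / m * (Y - (-s) ^ 2 / m)
        + (1 / (n : ℝ) + 1 / (m : ℝ)) * c * (s ^ 2 / n + s ^ 2 / m) := by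
    field_simp; ring
  have e' : (-s) ^ 2 / (m : ℝ) = s ^ 2 / m := by ring
  rw [e'] at k2 b2 e
  linarith

lemma supra_nonneg {n m : ℕ} (hn : 2 ≤ n) (hm : 2 ≤ m)
    (L₁ : Matrix (Fin n) (Fin n) ℝ) (L₂ : Matrix (Fin m) (Fin m) ℝ)
    (hL₁ : L₁.PosSemidef) (hL₂ : L₂.PosSemidef) (c : ℝ) (hc : 0 ≤ c)
    (v : Fin n ⊕ Fin m → ℝ) :
    0 ≤ v ⬝ᵥ (supraLap L₁ L₂ (Matrix.of fun _ _ => c / ((n : ℝ) * m)) *ᵥ v) := by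
  have hn0 : (0:ℝ) < n := by exact_mod_cast (by omega : 0 < n)
  have hm0 : (0:ℝ) < m := by exact_mod_cast (by omega : 0 < m)
  rw [supra_form]
  have b1 := psd_form L₁ hL₁ (v ∘ Sum.inl)
  have b2 := psd_form L₂ hL₂ (v ∘ Sum.inr)
  have c1 : (∑ i, v (Sum.inl i)) ^ 2 ≤ n * ∑ i, (v (Sum.inl i)) ^ 2 := by
    simpa using sq_sum_le_card_mul_sum_sq (s := Finset.univ) (f := v ∘ Sum.inl)
  have c2 : (∑ i, v (Sum.inr i)) ^ 2 ≤ m * ∑ i, (v (Sum.inr i)) ^ 2 := by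
    simpa using sq_sum_le_card_mul_sum_sq (s := Finset.univ) (f := v ∘ Sum.inr)
  generalize ∑ i, v (Sum.inl i) = s at *
  generalize ∑ i, v (Sum.inr i) = t at *
  generalize ∑ i, (v (Sum.inl i)) ^ 2 = X at *
  generalize ∑ i, (v (Sum.inr i)) ^ 2 = Y at *
  have c1' : 0 ≤ X - s ^ 2 / n := by
    rw [sub_nonneg, div_le_iff₀ hn0]; linarith
  have c2' : 0 ≤ Y - t ^ 2 / m := by
    rw [sub_nonneg, div_le_iff₀ hm0]; linarith
  have e : m * (c / (n * m)) * X + n * (c / (n * m)) * Y - 2 * (c / (n * m)) * s * t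
      = c / n * (X - s ^ 2 / n) + c / m * (Y - t ^ 2 / m) + c * (s / n - t / m) ^ 2 := by
    field_simp; ring
  have : 0 ≤ c / n * (X - s ^ 2 / n) + c / m * (Y - t ^ 2 / m) + c * (s / n - t / m) ^ 2 := by
    positivity
  linarith

lemma lam2_nonneg {K : Type*} [Fintype K] (M : Matrix K K ℝ)
    (h : ∀ v : K → ℝ, 0 ≤ v ⬝ᵥ (M *ᵥ v)) : 0 ≤ lam2 M := by
  apply Real.sInf_nonneg
  rintro r ⟨v, -, -, rfl⟩
  exact div_nonneg (h v) (Finset.sum_nonneg fun i _ => sq_nonneg _)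

theorem stmt_15 {n m : ℕ} (hn : 2 ≤ n) (hm : 2 ≤ m)
    (L₁ : Matrix (Fin n) (Fin n) ℝ) (L₂ : Matrix (Fin m) (Fin m) ℝ)
    (hL₁ : L₁.PosSemidef) (hL₂ : L₂.PosSemidef)
    (hL₁1 : L₁ *ᵥ (fun _ => 1) = 0) (hL₂1 : L₂ *ᵥ (fun _ => 1) = 0)
    (hnm : n > m) (hspec : (m : ℝ) * lam2 L₁ < (n : ℝ) * lam2 L₂) :
    let cstar : ℝ := (m : ℝ) * lam2 L₁
    (∀ c : ℝ, 0 ≤ c → c ≤ cstar →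
      lam2 (supraLap L₁ L₂ (Matrix.of fun _ _ => c / ((n : ℝ) * m))) =
        (1 / (n : ℝ) + 1 / (m : ℝ)) * c) ∧
    (∀ c : ℝ, cstar ≤ c →
      lam2 (supraLap L₁ L₂ (Matrix.of fun _ _ => c / ((n : ℝ) * m))) =
        lam2 L₁ + c / n) := by
  intro cstar
  have hn0 : (0:ℝ) < n := by exact_mod_cast (by omega : 0 < n)
  have hm0 : (0:ℝ) < m := by exact_mod_cast (by omega : 0 < m)
  have hnm' : (m:ℝ) < n := by exact_mod_cast hnm
  have hl : 0 ≤ lam2 L₁ := lam2_nonneg L₁ (psd_form L₁ hL₁)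
  have hcs : 0 ≤ cstar := by positivity
  let u : Fin n ⊕ Fin m → ℝ := Sum.elim (fun _ => (m:ℝ)) (fun _ => -(n:ℝ))
  have hu0 : u ≠ 0 := by
    intro h
    have := congrFun h (Sum.inl ⟨0, by omega⟩)
    simp [u] at this
    omega
  have hus : ∑ i, u i = 0 := by
    simp [u, Fintype.sum_sum_type]; ring
  constructor
  · intro c hc0 hc
    have hc' : c ≤ m * lam2 L₁ := hc
    apply le_antisymm
    · have h := lam2_mul_le _ (supra_nonneg hn hm L₁ L₂ hL₁ hL₂ c hc0) u hus
      rw [supra_form] at h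
      have a1 : u ∘ Sum.inl = (m:ℝ) • fun _ => (1:ℝ) := by ext; simp [u]
      have a2 : u ∘ Sum.inr = (-(n:ℝ)) • fun _ => (1:ℝ) := by ext; simp [u]
      rw [a1, a2, Matrix.mulVec_smul, Matrix.mulVec_smul, hL₁1, hL₂1] at h
      have hp := sumsq_pos u hu0
      refine le_of_mul_le_mul_right (h.trans (le_of_eq ?_)) hp
      simp [u, Fintype.sum_sum_type]
      field_simp
      ring
    · refine le_lam2 _ _ ⟨u, hu0, hus⟩ fun v _ hs =>
        supra_lower hn hm L₁ L₂ hL₁ hL₂ hL₁1 hL₂1 c _ ?_ ?_ le_rfl v hs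
      · have : c / m ≤ lam2 L₁ := by rw [div_le_iff₀ hm0]; linarith
        have e : (1 / (n : ℝ) + 1 / (m : ℝ)) * c = c / m + c / n := by ring
        linarith
      · have : c / n ≤ lam2 L₂ := by rw [div_le_iff₀ hn0]; linarith
        have e : (1 / (n : ℝ) + 1 / (m : ℝ)) * c = c / m + c / n := by ring
        linarith
  · intro c hc
    have hc' : m * lam2 L₁ ≤ c := hc
    have hc0 : 0 ≤ c := hcs.trans hc
    apply le_antisymm
    · rw [← sub_le_iff_le_add]
      refine le_lam2 _ _ ?_ ?_
      · have h01 : (⟨0, by omega⟩ : Fin n) ≠ ⟨1, by omega⟩ := by simp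
        refine ⟨Pi.single ⟨0, by omega⟩ 1 - Pi.single ⟨1, by omega⟩ 1, ?_, ?_⟩
        · intro h
          have := congrFun h ⟨0, by omega⟩
          simp at this
        · simp [Finset.sum_sub_distrib]
      · intro x _ hs
        have h := lam2_mul_le _ (supra_nonneg hn hm L₁ L₂ hL₁ hL₂ c hc0)
          (Sum.elim x (fun _ => 0)) (by simp [Fintype.sum_sum_type, hs])
        rw [supra_form] at h
        have a2 : (Sum.elim x (fun _ => (0:ℝ)) : Fin n ⊕ Fin m → ℝ) ∘ Sum.inr = 0 := by
          ext; simp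
        rw [a2] at h
        have e : (m:ℝ) * (c / (n * m)) = c / n := by field_simp
        simp [Fintype.sum_sum_type, e] at h
        linarith
    · have hd : lam2 L₁ ≤ c / m := by rw [le_div_iff₀ hm0]; linarith
      refine le_lam2 _ _ ⟨u, hu0, hus⟩ fun v _ hs =>
        supra_lower hn hm L₁ L₂ hL₁ hL₂ hL₁1 hL₂1 c _ le_rfl ?_ ?_ v hs
      · have k1 : m * lam2 L₁ / n ≤ lam2 L₂ := by rw [div_le_iff₀ hn0]; linarith
        have k2 : 0 ≤ (c - m * lam2 L₁) * ((n - m) / (n * m)) :=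
          mul_nonneg (by linarith) (div_nonneg (by linarith) (by positivity))
        have e : (c - m * lam2 L₁) * ((n - m) / (n * m)) =
            c / m - c / n - lam2 L₁ + m * lam2 L₁ / n := by
          field_simp
          ring
        linarith
      · have e : (1 / (n : ℝ) + 1 / (m : ℝ)) * c = c / m + c / n := by ring
        linarith
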